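/- Let D be a strongly first order generalized dependency. Then its downwards closure D↓ is also strongly first order; and if D is moreover relativizable, then D↓ is relativizable. -/

import Mathlib

namespace DSFO

/-- A purely relational signature: for each arity, a type of relation symbols. -/
abbrev Signature := ℕ → Type

/-- The empty signature. -/
def Sig0 : Signature := fun _ => Empty

/-- The signature with a single `k`-ary relation symbol `R`. -/
def SigR (k : ℕ) : Signature := fun n => PLift (n = k)

/-- Syntax of team-semantics formulas (in negation normal form, with the two
additional connectives: global disjunction `gdisj` and contradictory negation
`cneg`) over a relational signature `S`, with generalized dependency atoms
indexed by `ι` with arities `ar`.  Variables are natural numbers. -/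
inductive TS (S : Signature) (ι : Type) (ar : ι → ℕ) : Type
  | rel {k : ℕ} (r : S k) (v : Fin k → ℕ)
  | nrel {k : ℕ} (r : S k) (v : Fin k → ℕ)
  | eq (x y : ℕ)
  | neq (x y : ℕ)
  | dep (i : ι) (v : Fin (ar i) → ℕ)
  | and (φ ψ : TS S ι ar)
  | or (φ ψ : TS S ι ar)
  | gdisj (φ ψ : TS S ι ar)
  | cneg (φ : TS S ι ar)
  | ex (v : ℕ) (φ : TS S ι ar)
  | al (v : ℕ) (φ : TS S ι ar)

/-- The always-true literal `⊤`. -/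
def TS.top {S : Signature} {ι : Type} {ar : ι → ℕ} : TS S ι ar := .eq 0 0

/-- The arity function for "no dependency atoms". -/
def noAtoms : Empty → ℕ := fun e => e.elim

/-- First-order formulas over `S` (no dependency atoms; here `cneg` plays the
role of ordinary classical negation and `gdisj` of ordinary disjunction, so
this is full first-order logic). -/
abbrev FOF (S : Signature) := TS S Empty noAtoms

/-- First-order formulas over the empty signature. -/
abbrev EF := FOF Sig0

/-- Free variables of a formula. -/
def fv {S : Signature} {ι : Type} {ar : ι → ℕ} : TS S ι ar → Set ℕ
  | .rel _ v => Set.range v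
  | .nrel _ v => Set.range v
  | .eq x y => {x, y}
  | .neq x y => {x, y}
  | .dep _ v => Set.range v
  | .and φ ψ => fv φ ∪ fv ψ
  | .or φ ψ => fv φ ∪ fv ψ
  | .gdisj φ ψ => fv φ ∪ fv ψ
  | .cneg φ => fv φ
  | .ex v φ => fv φ \ {v}
  | .al v φ => fv φ \ {v}

/-- A sentence is a formula with no free variables. -/
def IsSentence {S : Signature} {ι : Type} {ar : ι → ℕ} (φ : TS S ι ar) : Prop :=
  fv φ = ∅

/-- No global disjunctions occur. -/
def NoGdisj {S : Signature} {ι : Type} {ar : ι → ℕ} : TS S ι ar → Prop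
  | .rel _ _ => True
  | .nrel _ _ => True
  | .eq _ _ => True
  | .neq _ _ => True
  | .dep _ _ => True
  | .and φ ψ => NoGdisj φ ∧ NoGdisj ψ
  | .or φ ψ => NoGdisj φ ∧ NoGdisj ψ
  | .gdisj _ _ => False
  | .cneg φ => NoGdisj φ
  | .ex _ φ => NoGdisj φ
  | .al _ φ => NoGdisj φ

/-- No contradictory negations occur. -/
def NoCneg {S : Signature} {ι : Type} {ar : ι → ℕ} : TS S ι ar → Prop
  | .rel _ _ => True
  | .nrel _ _ => True
  | .eq _ _ => True
  | .neq _ _ => True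
  | .dep _ _ => True
  | .and φ ψ => NoCneg φ ∧ NoCneg ψ
  | .or φ ψ => NoCneg φ ∧ NoCneg ψ
  | .gdisj φ ψ => NoCneg φ ∧ NoCneg ψ
  | .cneg _ => False
  | .ex _ φ => NoCneg φ
  | .al _ φ => NoCneg φ

/-- Formulas of `FO(𝒟)` proper: no `gdisj` and no `cneg`. -/
def Plain {S : Signature} {ι : Type} {ar : ι → ℕ} (φ : TS S ι ar) : Prop :=
  NoCneg φ ∧ NoGdisj φ

/-- Atomic formulas: first-order literals and dependency atoms. -/
def Atomic {S : Signature} {ι : Type} {ar : ι → ℕ} : TS S ι ar → Prop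
  | .rel _ _ => True
  | .nrel _ _ => True
  | .eq _ _ => True
  | .neq _ _ => True
  | .dep _ _ => True
  | _ => False

/-- Formulas of `FO(∼₀, 𝒟)`: the contradictory negation may appear only in
front of first-order literals and dependency atoms (and there is no `gdisj`). -/
def Cneg0 {S : Signature} {ι : Type} {ar : ι → ℕ} : TS S ι ar → Prop
  | .rel _ _ => True
  | .nrel _ _ => True
  | .eq _ _ => True
  | .neq _ _ => True
  | .dep _ _ => True
  | .and φ ψ => Cneg0 φ ∧ Cneg0 ψ
  | .or φ ψ => Cneg0 φ ∧ Cneg0 ψ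
  | .gdisj _ _ => False
  | .cneg φ => Atomic φ
  | .ex _ φ => Cneg0 φ
  | .al _ φ => Cneg0 φ

/-- The negation normal form of the (dual) negation of a formula. -/
def TS.nneg {S : Signature} {ι : Type} {ar : ι → ℕ} : TS S ι ar → TS S ι ar
  | .rel r v => .nrel r v
  | .nrel r v => .rel r v
  | .eq x y => .neq x y
  | .neq x y => .eq x y
  | .dep i v => .cneg (.dep i v)
  | .and φ ψ => .or (TS.nneg φ) (TS.nneg ψ)
  | .or φ ψ => .and (TS.nneg φ) (TS.nneg ψ)
  | .gdisj φ ψ => .and (TS.nneg φ) (TS.nneg ψ)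
  | .cneg φ => φ
  | .ex v φ => .al v (TS.nneg φ)
  | .al v φ => .ex v (TS.nneg φ)

/-- Iterated existential quantification over a list of variables. -/
def exs {S : Signature} {ι : Type} {ar : ι → ℕ} (l : List ℕ) (φ : TS S ι ar) :
    TS S ι ar := l.foldr TS.ex φ

/-- An interpretation of a relational signature in a domain `M`. -/
abbrev Interp (S : Signature) (M : Type) := ∀ k, S k → Set (Fin k → M)

/-- The unique interpretation of the empty signature. -/
def eI (M : Type) : Interp Sig0 M := fun _ e => e.elim

/-- The interpretation of `SigR k` given by a `k`-ary relation `R`. -/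
def interpR {k : ℕ} {M : Type} (R : Set (Fin k → M)) : Interp (SigR k) M :=
  fun _ r => {s | (fun i => s (Fin.cast r.down.symm i)) ∈ R}

/-- Tarskian (single-assignment) satisfaction.  Dependency atoms are
(vacuously) interpreted as true; this is only used on first-order formulas. -/
def FSat {S : Signature} {ι : Type} {ar : ι → ℕ} (M : Type) (I : Interp S M) :
    (ℕ → M) → TS S ι ar → Prop
  | s, .rel r v => (fun i => s (v i)) ∈ I _ r
  | s, .nrel r v => (fun i => s (v i)) ∉ I _ r
  | s, .eq x y => s x = s y
  | s, .neq x y => s x ≠ s y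
  | _, .dep _ _ => True
  | s, .and φ ψ => FSat M I s φ ∧ FSat M I s ψ
  | s, .or φ ψ => FSat M I s φ ∨ FSat M I s ψ
  | s, .gdisj φ ψ => FSat M I s φ ∨ FSat M I s ψ
  | s, .cneg φ => ¬ FSat M I s φ
  | s, .ex v φ => ∃ m : M, FSat M I (Function.update s v m) φ
  | s, .al v φ => ∀ m : M, FSat M I (Function.update s v m) φ

/-- Truth of a first-order sentence (Tarskian semantics). -/
def FOTrue {S : Signature} {ι : Type} {ar : ι → ℕ} (M : Type) (I : Interp S M)
    (φ : TS S ι ar) : Prop :=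
  ∀ s : ℕ → M, FSat M I s φ

/-- The relation `X(x̄)` determined by a team `X` and a tuple of variables `x̄`. -/
def teamProj {M : Type} {k : ℕ} (v : Fin k → ℕ) (X : Set (ℕ → M)) :
    Set (Fin k → M) := {t | ∃ s ∈ X, t = fun j => s (v j)}

/-- (Lax) team semantics.  `A` gives the semantics of each dependency atom as a
function of the relation `X(x̄)`. -/
def TSat {S : Signature} {ι : Type} {ar : ι → ℕ} (M : Type) (I : Interp S M)
    (A : ∀ i, Set (Fin (ar i) → M) → Prop) :
    TS S ι ar → Set (ℕ → M) → Prop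
  | .rel r v, X => ∀ s ∈ X, (fun i => s (v i)) ∈ I _ r
  | .nrel r v, X => ∀ s ∈ X, (fun i => s (v i)) ∉ I _ r
  | .eq x y, X => ∀ s ∈ X, s x = s y
  | .neq x y, X => ∀ s ∈ X, s x ≠ s y
  | .dep i v, X => A i (teamProj v X)
  | .and φ ψ, X => TSat M I A φ X ∧ TSat M I A ψ X
  | .or φ ψ, X => ∃ Y Z : Set (ℕ → M), Y ∪ Z = X ∧ TSat M I A φ Y ∧ TSat M I A ψ Z
  | .gdisj φ ψ, X => TSat M I A φ X ∨ TSat M I A ψ X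
  | .cneg φ, X => ¬ TSat M I A φ X
  | .ex v φ, X => ∃ H : (ℕ → M) → Set M, (∀ s ∈ X, (H s).Nonempty) ∧
      TSat M I A φ {s' | ∃ s ∈ X, ∃ m ∈ H s, s' = Function.update s v m}
  | .al v φ, X => TSat M I A φ {s' | ∃ s ∈ X, ∃ m : M, s' = Function.update s v m}

/-- Truth of a sentence under team semantics: satisfaction by the team of all
assignments (by locality, equivalent to satisfaction by `{∅}`). -/
def TTrue {S : Signature} {ι : Type} {ar : ι → ℕ} (M : Type) (I : Interp S M)
    (A : ∀ i, Set (Fin (ar i) → M) → Prop) (φ : TS S ι ar) : Prop :=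
  TSat M I A φ Set.univ

/-- A `k`-ary dependency predicate: a class of pairs `(M, R)`. -/
abbrev DepPred (k : ℕ) := ∀ M : Type, Set (Fin k → M) → Prop

/-- Closure under isomorphisms (part of the definition of a generalized
dependency). -/
def IsoClosed {k : ℕ} (D : DepPred k) : Prop :=
  ∀ (M N : Type) (e : M ≃ N) (R : Set (Fin k → M)),
    D M R → D N ((fun f => e ∘ f) '' R)

/-- The complement `∼D` of a dependency. -/
def complD {k : ℕ} (D : DepPred k) : DepPred k := fun M R => ¬ D M R

def DownwardsClosed {k : ℕ} (D : DepPred k) : Prop :=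
  ∀ (M : Type) (R R' : Set (Fin k → M)), D M R → R' ⊆ R → D M R'

/-- The downwards closure `D↓`. -/
def dClosure {k : ℕ} (D : DepPred k) : DepPred k :=
  fun M R => ∃ R', R ⊆ R' ∧ D M R'

/-- `D_max`: the maximal models of `D`. -/
def DMax {k : ℕ} (D : DepPred k) : DepPred k :=
  fun M R => D M R ∧ ∀ R', R ⊂ R' → ¬ D M R'

/-- The empty team property. -/
def EmptyTeamProp {k : ℕ} (D : DepPred k) : Prop :=
  ∀ M : Type, Nontrivial M → D M (∅ : Set (Fin k → M))

/-- `D` is a first-order dependency: it is the class of models of a first-order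
sentence over the signature `{R}`. -/
def FirstOrderDep {k : ℕ} (D : DepPred k) : Prop :=
  ∃ ψ : FOF (SigR k), IsSentence ψ ∧
    ∀ (M : Type), Nontrivial M → ∀ R : Set (Fin k → M),
      (D M R ↔ FOTrue M (interpR R) ψ)

/-- The interpretation of a unary predicate symbol as a subset of the domain. -/
def PSet {S : Signature} {M : Type} (I : Interp S M) (P : S 1) : Set M :=
  {m | (fun _ => m) ∈ I 1 P}

/-- Semantics of the relativization `D^(P)` of `D` to the unary predicate `P`:
`𝔐 ⊨_X D^(P) x̄` iff `(P^𝔐, X(x̄)) ∈ D`. -/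
def relSem {k : ℕ} (D : DepPred k) {S : Signature} (P : S 1)
    (M : Type) (I : Interp S M) (R : Set (Fin k → M)) : Prop :=
  (∀ f ∈ R, ∀ j, f j ∈ PSet I P) ∧
    D (↥(PSet I P)) {g : Fin k → ↥(PSet I P) | (fun j => (g j : M)) ∈ R}

/-- A family `𝒟` of generalized dependencies is strongly first order: every
sentence of `FO(𝒟)` is equivalent to some first-order sentence. -/
def SFOFam {ι : Type} {ar : ι → ℕ} (D : ∀ i, DepPred (ar i)) : Prop :=
  ∀ (S : Signature) (φ : TS S ι ar), IsSentence φ → Plain φ →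
    ∃ ψ : FOF S, IsSentence ψ ∧
      ∀ (M : Type), Nontrivial M → ∀ I : Interp S M,
        (TTrue M I (fun i => D i M) φ ↔ FOTrue M I ψ)

/-- A single dependency is strongly first order iff `{D}` is. -/
def SFOd {k : ℕ} (D : DepPred k) : Prop :=
  SFOFam (ι := Unit) (ar := fun _ => k) (fun _ => D)

/-- A family `𝒟` is relativizable: every sentence of `FO(𝒟^(P))` is equivalent
to some sentence of `FO(𝒟)`. -/
def RelativizableFam {ι : Type} {ar : ι → ℕ} (D : ∀ i, DepPred (ar i)) : Prop :=
  ∀ (S : Signature) (P : S 1) (φ : TS S ι ar), IsSentence φ → Plain φ →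
    ∃ ψ : TS S ι ar, IsSentence ψ ∧ Plain ψ ∧
      ∀ (M : Type), Nontrivial M → ∀ I : Interp S M,
        (TTrue M I (fun i => relSem (D i) P M I) φ ↔ TTrue M I (fun i => D i M) ψ)

def Relativizable1 {k : ℕ} (D : DepPred k) : Prop :=
  RelativizableFam (ι := Unit) (ar := fun _ => k) (fun _ => D)

/-- The family `𝒟 ∪ ∼𝒟`. -/
def withComplFam {ι : Type} {ar : ι → ℕ} (D : ∀ i, DepPred (ar i)) :
    ∀ i : ι ⊕ ι, DepPred (Sum.elim ar ar i) :=
  fun i => match i with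
    | .inl a => D a
    | .inr a => complD (D a)

/-- `D` is doubly strongly first order: `{D, ∼D}` is strongly first order. -/
def DSFOd {k : ℕ} (D : DepPred k) : Prop :=
  SFOFam (ι := Bool) (ar := fun _ => k)
    (fun b => match b with | true => D | false => complD D)

/-- The constancy atom of arity `k`. -/
def constD (k : ℕ) : DepPred k := fun _ R => ∀ f ∈ R, ∀ g ∈ R, f = g

/-- The totality atom of arity `k`. -/
def allD (k : ℕ) : DepPred k := fun M R => R = (Set.univ : Set (Fin k → M))

/-- The family `𝒟 ∪ {const}` (constancy atoms of every arity). -/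
def withConst {ι : Type} {ar : ι → ℕ} (D : ∀ i, DepPred (ar i)) :
    ∀ i : ι ⊕ ℕ, DepPred (Sum.elim ar id i) :=
  fun i => match i with
    | .inl a => D a
    | .inr n => constD n

/-- The atoms of `𝒟^(P) ∪ {const}`. -/
def withConstRel {ι : Type} {ar : ι → ℕ} (D : ∀ i, DepPred (ar i))
    {S : Signature} (P : S 1) (M : Type) (I : Interp S M) :
    ∀ i : ι ⊕ ℕ, Set (Fin (Sum.elim ar id i) → M) → Prop :=
  fun i => match i with
    | .inl a => relSem (D a) P M I
    | .inr n => constD n M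

/-- Atom indices of the logic `FO(𝒟₀, ⊔, const, All)`: the 0-ary first-order
dependencies `[ψ]`, the constancy atoms and the totality atoms. -/
inductive CIdx : Type
  | d0 (ψ : EF) (hψ : IsSentence ψ)
  | const (k : ℕ)
  | total (k : ℕ)

def cAr : CIdx → ℕ
  | .d0 _ _ => 0
  | .const k => k
  | .total k => k

def cSem (M : Type) : ∀ i : CIdx, Set (Fin (cAr i) → M) → Prop
  | .d0 ψ _, _ => FOTrue M (eI M) ψ
  | .const _, R => ∀ f ∈ R, ∀ g ∈ R, f = g
  | .total _, R => R = Set.univ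

/-- Embedding of first-order formulas over the empty signature into any
team logic. -/
def embedEF {S : Signature} {ι : Type} {ar : ι → ℕ} : EF → TS S ι ar
  | .rel r _ => Empty.elim r
  | .nrel r _ => Empty.elim r
  | .eq x y => .eq x y
  | .neq x y => .neq x y
  | .dep i _ => Empty.elim i
  | .and φ ψ => .and (embedEF φ) (embedEF ψ)
  | .or φ ψ => .or (embedEF φ) (embedEF ψ)
  | .gdisj φ ψ => .gdisj (embedEF φ) (embedEF ψ)
  | .cneg φ => .cneg (embedEF φ)
  | .ex v φ => .ex v (embedEF φ)
  | .al v φ => .al v (embedEF φ)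

/-- Override the values of the variables `0, …, k-1` by the tuple `f`. -/
def overrideFin {M : Type} (k : ℕ) (f : Fin k → M) (s : ℕ → M) : ℕ → M :=
  fun v => if h : v < k then f ⟨v, h⟩ else s v

/-- `(M, R) ⊨ ∃ȳ ∀x̄ (R x̄ → θ(x̄, ȳ))`, where `x̄` is the tuple of variables
`0, …, k-1` and the remaining free variables `ȳ` of `θ` are witnessed by `s`. -/
def ExAllSem {k : ℕ} (M : Type) (R : Set (Fin k → M)) (θ : EF) : Prop :=
  ∃ s : ℕ → M, ∀ f ∈ R, FSat M (eI M) (overrideFin k f s) θ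

/-- `(M, R) ⊨ ∃ȳ ∀x̄ (R x̄ ↔ θ(x̄, ȳ))`. -/
def ExAllIffSem {k : ℕ} (M : Type) (R : Set (Fin k → M)) (θ : EF) : Prop :=
  ∃ s : ℕ → M, ∀ f : Fin k → M, (f ∈ R ↔ FSat M (eI M) (overrideFin k f s) θ)

/-- The assignment sending `x̄ = (0, …, k-1)` to `f`, `ȳ = (k, …, k+n-1)` to
`a`, and every other variable to its value under `s0`. -/
def tupAsg {M : Type} (k n : ℕ) (f : Fin k → M) (a : Fin n → M) (s0 : ℕ → M) :
    ℕ → M :=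
  fun v => if h : v < k then f ⟨v, h⟩ else if h2 : v - k < n then a ⟨v - k, h2⟩ else s0 v

/-- `R` is defined by the formula `θ(x̄, ȳ)` (with `x̄ = (0, …, k-1)` and
`ȳ = (k, …, k+n-1)`): there is a tuple `ā` of parameters such that
`R = {m̄ : 𝔐 ⊨ θ(m̄, ā)}`. -/
def DefinedBy {S : Signature} {M : Type} (I : Interp S M) (k n : ℕ)
    (θ : FOF S) (R : Set (Fin k → M)) : Prop :=
  ∃ a : Fin n → M, ∀ s0 : ℕ → M, R = {f | FSat M I (tupAsg k n f a s0) θ}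

/-- `θ(x̄, ȳ)` fixes the identity type of `ȳ = (k, …, k+n-1)`. -/
def FixesIdType {S : Signature} (k n : ℕ) (θ : FOF S) : Prop :=
  ∀ i j : Fin n,
    (∀ (M : Type), Nontrivial M → ∀ (I : Interp S M) (s : ℕ → M),
        FSat M I s θ → s (k + (i : ℕ)) = s (k + (j : ℕ))) ∨
    (∀ (M : Type), Nontrivial M → ∀ (I : Interp S M) (s : ℕ → M),
        FSat M I s θ → s (k + (i : ℕ)) ≠ s (k + (j : ℕ)))

/-- `(M, R := Xv) ⊨ ∃ȳ ∀x̄ (R x̄ → θ(x̄, ȳ))` where the `x̄`-slots of `θ` are the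
variables `v̄` and the `ȳ`-slots are the variables `ȳ`. -/
def projExAll {M : Type} {k n : ℕ} (v : Fin k → ℕ) (y : Fin n → ℕ) (θ : EF)
    (Xv : Set (Fin k → M)) : Prop :=
  ∃ b : Fin n → M, ∀ f ∈ Xv, ∀ s : ℕ → M,
    (∀ j, s (v j) = f j) → (∀ i, s (y i) = b i) → FSat M (eI M) s θ


section DownwardClosure

variable {S : Signature} {ι : Type} {ar : ι → ℕ} {k : ℕ} {M : Type}

/-! ### First-order formulas: locality, Boolean combinations, negation normal form -/

theorem FSat_congr (I : Interp S M) (φ : TS S ι ar) {s s' : ℕ → M}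
    (h : ∀ x ∈ fv φ, s x = s' x) : FSat M I s φ ↔ FSat M I s' φ := by
  induction φ generalizing s s' with
  | rel r v | nrel r v =>
    have : (fun i => s (v i)) = fun i => s' (v i) := funext fun i => h _ ⟨i, rfl⟩
    simp only [FSat, this]
  | eq x y | neq x y =>
    simp only [FSat, h x (by simp [fv]), h y (by simp [fv])]
  | dep i v => simp only [FSat]
  | and φ ψ ih₁ ih₂ | or φ ψ ih₁ ih₂ | gdisj φ ψ ih₁ ih₂ =>
    simp only [FSat, ih₁ fun x hx => h x (Or.inl hx), ih₂ fun x hx => h x (Or.inr hx)]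
  | cneg φ ih => simp only [FSat, ih h]
  | ex v φ ih | al v φ ih =>
    have key (m : M) := ih (s := Function.update s v m) (s' := Function.update s' v m) (by
      intro x hx
      by_cases hxv : x = v
      · simp [hxv]
      · simpa [hxv] using h x ⟨hx, hxv⟩)
    simp only [FSat, key]

theorem FOTrue_iff_FSat (I : Interp S M) {φ : TS S ι ar} (hφ : IsSentence φ) (s : ℕ → M) :
    FOTrue M I φ ↔ FSat M I s φ :=
  ⟨fun h => h s, fun h s' => (FSat_congr I φ (by simp [show fv φ = ∅ from hφ])).1 h⟩

/-- A class of `S`-structures is first-order definable on nontrivial domains. -/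
def FODefinable (Q : ∀ M : Type, Interp S M → Prop) : Prop :=
  ∃ ψ : FOF S, IsSentence ψ ∧
    ∀ M : Type, Nontrivial M → ∀ I : Interp S M, (Q M I ↔ FOTrue M I ψ)

theorem FODefinable.and {Q Q' : ∀ M : Type, Interp S M → Prop}
    (h : FODefinable Q) (h' : FODefinable Q') : FODefinable fun M I => Q M I ∧ Q' M I := by
  obtain ⟨ψ, hψ, H⟩ := h
  obtain ⟨ψ', hψ', H'⟩ := h'
  refine ⟨.and ψ ψ', ?_, fun M hM I => ?_⟩
  · simp_all [IsSentence, fv]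
  · exact (and_congr (H M hM I) (H' M hM I)).trans forall_and.symm

theorem FODefinable.or {Q Q' : ∀ M : Type, Interp S M → Prop}
    (h : FODefinable Q) (h' : FODefinable Q') : FODefinable fun M I => Q M I ∨ Q' M I := by
  obtain ⟨ψ, hψ, H⟩ := h
  obtain ⟨ψ', hψ', H'⟩ := h'
  have hs : IsSentence (TS.or ψ ψ') := by simp_all [IsSentence, fv]
  refine ⟨.or ψ ψ', hs, fun M hM I => ?_⟩
  obtain ⟨m⟩ := hM.to_nonempty
  refine (or_congr (H M hM I) (H' M hM I)).trans ?_
  rw [FOTrue_iff_FSat I hψ fun _ => m, FOTrue_iff_FSat I hψ' fun _ => m,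
    FOTrue_iff_FSat I hs fun _ => m]
  rfl

theorem FODefinable.false : FODefinable (S := S) fun _ _ => False := by
  refine ⟨.al 0 (.neq 0 0), by simp [IsSentence, fv], fun M hM I => ?_⟩
  obtain ⟨m⟩ := hM.to_nonempty
  simp only [false_iff]
  exact fun h => h (fun _ => m) m rfl

theorem FODefinable.exists_mem {α : Type*} (l : List α)
    {Q : α → ∀ M : Type, Interp S M → Prop} (h : ∀ a ∈ l, FODefinable (Q a)) :
    FODefinable fun M I => ∃ a ∈ l, Q a M I := by
  induction l with
  | nil => simpa using FODefinable.false
  | cons a l ih =>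
    simpa using (h a (by simp)).or (ih fun b hb => h b (by simp [hb]))

/-- Negation normal form, inside any team logic, of a first-order formula
(`true`) or of its negation (`false`). -/
def nnf : Bool → FOF S → TS S ι ar
  | true, .rel r v => .rel r v
  | false, .rel r v => .nrel r v
  | true, .nrel r v => .nrel r v
  | false, .nrel r v => .rel r v
  | true, .eq x y => .eq x y
  | false, .eq x y => .neq x y
  | true, .neq x y => .neq x y
  | false, .neq x y => .eq x y
  | _, .dep i _ => i.elim
  | true, .and φ ψ => .and (nnf true φ) (nnf true ψ)
  | false, .and φ ψ => .or (nnf false φ) (nnf false ψ)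
  | true, .or φ ψ => .or (nnf true φ) (nnf true ψ)
  | false, .or φ ψ => .and (nnf false φ) (nnf false ψ)
  | true, .gdisj φ ψ => .or (nnf true φ) (nnf true ψ)
  | false, .gdisj φ ψ => .and (nnf false φ) (nnf false ψ)
  | b, .cneg φ => nnf (!b) φ
  | true, .ex v φ => .ex v (nnf true φ)
  | false, .ex v φ => .al v (nnf false φ)
  | true, .al v φ => .al v (nnf true φ)
  | false, .al v φ => .ex v (nnf false φ)

theorem fv_nnf (b : Bool) (φ : FOF S) : fv (nnf b φ : TS S ι ar) = fv φ := by
  induction φ generalizing b with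
  | dep i v => exact i.elim
  | _ => cases b <;> simp_all [nnf, fv]

theorem plain_nnf (b : Bool) (φ : FOF S) : Plain (nnf b φ : TS S ι ar) := by
  induction φ generalizing b with
  | dep i v => exact i.elim
  | _ => cases b <;> simp_all [nnf, Plain, NoCneg, NoGdisj]

theorem flat_or {p q : (ℕ → M) → Prop} (X : Set (ℕ → M)) :
    (∃ Y Z : Set (ℕ → M), Y ∪ Z = X ∧ (∀ s ∈ Y, p s) ∧ ∀ s ∈ Z, q s) ↔
      ∀ s ∈ X, p s ∨ q s := by
  constructor
  · rintro ⟨Y, Z, rfl, hY, hZ⟩ s (hs | hs)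
    · exact .inl (hY s hs)
    · exact .inr (hZ s hs)
  · intro h
    refine ⟨{s ∈ X | p s}, {s ∈ X | q s}, ?_, fun s hs => hs.2, fun s hs => hs.2⟩
    ext s
    constructor
    · rintro (hs | hs) <;> exact hs.1
    · exact fun hs => (h s hs).imp (⟨hs, ·⟩) (⟨hs, ·⟩)

theorem flat_ex {p : (ℕ → M) → Prop} (v : ℕ) (X : Set (ℕ → M)) :
    (∃ H : (ℕ → M) → Set M, (∀ s ∈ X, (H s).Nonempty) ∧
      ∀ s' ∈ {s' | ∃ s ∈ X, ∃ m ∈ H s, s' = Function.update s v m}, p s') ↔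
      ∀ s ∈ X, ∃ m, p (Function.update s v m) := by
  constructor
  · rintro ⟨H, hne, h⟩ s hs
    obtain ⟨m, hm⟩ := hne s hs
    exact ⟨m, h _ ⟨s, hs, m, hm, rfl⟩⟩
  · intro h
    refine ⟨fun s => {m | p (Function.update s v m)}, h, ?_⟩
    rintro _ ⟨s, _, m, hm, rfl⟩
    exact hm

theorem flat_al {p : (ℕ → M) → Prop} (v : ℕ) (X : Set (ℕ → M)) :
    (∀ s' ∈ {s' | ∃ s ∈ X, ∃ m : M, s' = Function.update s v m}, p s') ↔
      ∀ s ∈ X, ∀ m, p (Function.update s v m) :=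
  ⟨fun h s hs m => h _ ⟨s, hs, m, rfl⟩, by rintro h _ ⟨s, hs, m, rfl⟩; exact h s hs m⟩

theorem TSat_nnf (I : Interp S M) (A : ∀ i, Set (Fin (ar i) → M) → Prop) (b : Bool)
    (φ : FOF S) (X : Set (ℕ → M)) :
    TSat M I A (nnf b φ) X ↔ ∀ s ∈ X, (FSat M I s φ ↔ b = true) := by
  induction φ generalizing b X with
  | dep i v => exact i.elim
  | cneg φ ih =>
    rw [nnf, ih]
    cases b <;> simp [FSat]
  | ex v φ ih | al v φ ih =>
    cases b <;> simp only [nnf, TSat, FSat, ih, flat_ex, flat_al] <;> simp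
  | and φ ψ ih₁ ih₂ | or φ ψ ih₁ ih₂ | gdisj φ ψ ih₁ ih₂ =>
    cases b <;> simp only [nnf, TSat, FSat, ih₁, ih₂, flat_or, ← forall₂_and] <;>
      simp [imp_iff_not_or]
  | _ => cases b <;> simp [nnf, TSat, FSat]

/-! ### Iterated existential quantification in lax team semantics -/

/-- Two assignments agree on all variables outside `l`. -/
def AgreeOff (l : List ℕ) (s s' : ℕ → M) : Prop := ∀ x ∉ l, s' x = s x

theorem TSat_exs (I : Interp S M) (A : ∀ i, Set (Fin (ar i) → M) → Prop) (l : List ℕ)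
    (φ : TS S ι ar) (X : Set (ℕ → M)) :
    TSat M I A (exs l φ) X ↔ ∃ Y, TSat M I A φ Y ∧ (∀ s ∈ X, ∃ s' ∈ Y, AgreeOff l s s') ∧
      ∀ s' ∈ Y, ∃ s ∈ X, AgreeOff l s s' := by
  induction l generalizing X with
  | nil =>
    have h (s s' : ℕ → M) : AgreeOff [] s s' ↔ s' = s := by simp [AgreeOff, funext_iff]
    simp only [h, exists_eq_right, exists_eq_right']
    exact ⟨fun hX => ⟨X, hX, fun _ => id, fun _ => id⟩, fun ⟨Y, hY, h₁, h₂⟩ =>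
      (show X = Y from Set.Subset.antisymm h₁ h₂) ▸ hY⟩
  | cons v l ih =>
    change (∃ H : (ℕ → M) → Set M, _ ∧ TSat M I A (exs l φ) _) ↔ _
    simp only [ih]
    constructor
    · rintro ⟨H, hne, Y, hY, h₁, h₂⟩
      have step {s s' : ℕ → M} {m : M} (h : AgreeOff l (Function.update s v m) s') :
          AgreeOff (v :: l) s s' := by
        intro x hx
        simp only [List.mem_cons, not_or] at hx
        simpa [hx.1] using h x hx.2
      refine ⟨Y, hY, fun s hs => ?_, fun s' hs' => ?_⟩
      · obtain ⟨m, hm⟩ := hne s hs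
        obtain ⟨s', hs', h⟩ := h₁ _ ⟨s, hs, m, hm, rfl⟩
        exact ⟨s', hs', step h⟩
      · obtain ⟨_, ⟨s, hs, m, -, rfl⟩, h⟩ := h₂ s' hs'
        exact ⟨s, hs, step h⟩
    · rintro ⟨Y, hY, h₁, h₂⟩
      have step {s s' : ℕ → M} (h : AgreeOff (v :: l) s s') :
          AgreeOff l (Function.update s v (s' v)) s' := by
        intro x hx
        by_cases hxv : x = v
        · simp [hxv]
        · simpa [hxv] using h x (by simp [hxv, hx])
      refine ⟨fun s => {m | ∃ s' ∈ Y, AgreeOff (v :: l) s s' ∧ m = s' v}, fun s hs => ?_,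
        Y, hY, ?_, fun s' hs' => ?_⟩
      · obtain ⟨s', hs', h⟩ := h₁ s hs
        exact ⟨_, s', hs', h, rfl⟩
      · rintro _ ⟨s, -, _, ⟨s', hs', h, rfl⟩, rfl⟩
        exact ⟨s', hs', step h⟩
      · obtain ⟨s, hs, h⟩ := h₂ s' hs'
        exact ⟨_, ⟨s, hs, _, ⟨s', hs', h, rfl⟩, rfl⟩, step h⟩

theorem fv_exs (l : List ℕ) (φ : TS S ι ar) : fv (exs l φ) = fv φ \ {x | x ∈ l} := by
  induction l with
  | nil => simp [exs]
  | cons v l ih =>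
    change fv (exs l φ) \ {v} = _
    rw [ih]
    ext x
    simp only [Set.mem_sdiff, Set.mem_ofPred_eq, Set.mem_singleton_iff, List.mem_cons, not_or]
    tauto

theorem plain_exs {l : List ℕ} {φ : TS S ι ar} (h : Plain φ) : Plain (exs l φ) := by
  induction l with
  | nil => exact h
  | cons v l ih => exact ih

/-- Override the values of the variables `N, …, N + k - 1` by the tuple `f`. -/
def setBlock (N : ℕ) (f : Fin k → M) (s : ℕ → M) : ℕ → M :=
  fun x => if h : N ≤ x ∧ x - N < k then f ⟨x - N, h.2⟩ else s x

theorem setBlock_add (N : ℕ) (f : Fin k → M) (s : ℕ → M) (j : Fin k) :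
    setBlock N f s (N + j) = f j := by
  simp [setBlock]

theorem setBlock_of_lt {N x : ℕ} (hx : x < N) (f : Fin k → M) (s : ℕ → M) :
    setBlock N f s x = s x := by
  simp [setBlock, hx.not_ge]

theorem agreeOff_setBlock (N : ℕ) (f : Fin k → M) (s : ℕ → M) :
    AgreeOff (List.range' N k) s (setBlock N f s) := by
  intro x hx
  rw [List.mem_range'_1] at hx
  exact dif_neg (by omega)

theorem AgreeOff.of_lt {N x : ℕ} {s s' : ℕ → M} (h : AgreeOff (List.range' N k) s s')
    (hx : x < N) : s' x = s x :=
  h x (by rw [List.mem_range'_1]; omega)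

/-! ### Expressing the downwards closure of an atom -/

/-- The conjunction of the identities `v j = w j`. -/
def tupleEq (v w : Fin k → ℕ) : TS S ι ar :=
  (List.finRange k).foldr (fun j φ => .and (.eq (v j) (w j)) φ) (.al 0 (.eq 0 0))

theorem TSat_tupleEq (I : Interp S M) (A : ∀ i, Set (Fin (ar i) → M) → Prop)
    (v w : Fin k → ℕ) (X : Set (ℕ → M)) :
    TSat M I A (tupleEq v w) X ↔ ∀ s ∈ X, ∀ j, s (v j) = s (w j) := by
  have key (l : List (Fin k)) :
      TSat M I A (l.foldr (fun j φ => .and (.eq (v j) (w j)) φ) (.al 0 (.eq 0 0))) X ↔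
        ∀ s ∈ X, ∀ j ∈ l, s (v j) = s (w j) := by
    induction l with
    | nil => simp [TSat]
    | cons j l ih => simp [TSat, ih, forall₂_and]
  exact (key _).trans (by simp)

theorem fv_tupleEq (v w : Fin k → ℕ) :
    fv (tupleEq v w : TS S ι ar) ⊆ Set.range v ∪ Set.range w := by
  have key (l : List (Fin k)) :
      fv (l.foldr (fun j φ => .and (.eq (v j) (w j)) φ) (.al 0 (.eq 0 0)) : TS S ι ar) ⊆
        Set.range v ∪ Set.range w := by
    induction l with
    | nil => simp [fv]
    | cons j l ih =>
      refine Set.union_subset ?_ ih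
      rintro _ (rfl | rfl)
      · exact .inl ⟨j, rfl⟩
      · exact .inr ⟨j, rfl⟩
  exact key _

theorem plain_tupleEq (v w : Fin k → ℕ) : Plain (tupleEq v w : TS S ι ar) := by
  have key (l : List (Fin k)) :
      Plain (l.foldr (fun j φ => .and (.eq (v j) (w j)) φ) (.al 0 (.eq 0 0)) : TS S ι ar) := by
    induction l with
    | nil => simp [Plain, NoCneg, NoGdisj]
    | cons j l ih => simpa [Plain, NoCneg, NoGdisj] using ih
  exact key _

/-- A strict upper bound for the variables of a tuple. -/
def varBound (v : Fin k → ℕ) : ℕ := Finset.univ.sup v + 1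

theorem lt_varBound (v : Fin k → ℕ) (j : Fin k) : v j < varBound v :=
  Nat.lt_succ_of_le (Finset.le_sup (f := v) (Finset.mem_univ j))

/-- `∀u ∀w ∃ȳ ((w ≠ u ∨ ȳ = v̄) ∧ D ȳ)` with `u`, `w`, `ȳ` fresh: it defines `D↓ v̄` on
nonempty teams. -/
def closureAtom (v : Fin k → ℕ) : TS S Unit fun _ => k :=
  .al (varBound v) (.al (varBound v + 1) (exs (List.range' (varBound v + 2) k)
    (.and (.or (.neq (varBound v + 1) (varBound v)) (tupleEq (varBound v + 2 + ·) v))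
      (.dep () (varBound v + 2 + ·)))))

/-- The downwards closure of a property of relations. -/
def downClosure (A : Set (Fin k → M) → Prop) (R : Set (Fin k → M)) : Prop :=
  ∃ R', R ⊆ R' ∧ A R'

theorem fv_closureAtom (v : Fin k → ℕ) :
    fv (closureAtom v : TS S Unit fun _ => k) ⊆ Set.range v := by
  intro x hx
  simp only [closureAtom, fv, fv_exs, Set.mem_sdiff, Set.mem_singleton_iff, Set.mem_union,
    Set.mem_insert_iff, Set.mem_ofPred_eq, List.mem_range'_1] at hx
  obtain ⟨⟨⟨((h | h) | h) | ⟨j, rfl⟩, h'⟩, hw⟩, hu⟩ := hx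
  · exact absurd h hw
  · exact absurd h hu
  · rcases fv_tupleEq _ _ h with ⟨j, rfl⟩ | h
    · exact absurd ⟨by simp, by simp⟩ h'
    · exact h
  · exact absurd ⟨by simp, by simp⟩ h'

theorem plain_closureAtom (v : Fin k → ℕ) : Plain (closureAtom v : TS S Unit fun _ => k) := by
  have h : Plain (exs (List.range' (varBound v + 2) k)
      (.and (.or (.neq (varBound v + 1) (varBound v)) (tupleEq (varBound v + 2 + ·) v))
      (.dep () (varBound v + 2 + ·))) : TS S Unit fun _ => k) :=
    plain_exs (by
      have := plain_tupleEq (S := S) (ι := Unit) (ar := fun _ => k) (varBound v + 2 + ·) v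
      simpa [Plain, NoCneg, NoGdisj] using this)
  exact h

theorem downClosure_of_TSat_closureAtom (I : Interp S M) {A : Set (Fin k → M) → Prop}
    {v : Fin k → ℕ} {X : Set (ℕ → M)} (h : TSat M I (fun _ => A) (closureAtom v) X) :
    downClosure A (teamProj v X) := by
  simp only [closureAtom, TSat, TSat_exs, TSat_tupleEq, flat_or] at h
  obtain ⟨Y, ⟨hor, hA⟩, h₁, -⟩ := h
  refine ⟨_, ?_, hA⟩
  rintro _ ⟨s, hs, rfl⟩
  obtain ⟨s', hs', hag⟩ := h₁ _ ⟨_, ⟨s, hs, s 0, rfl⟩, s 0, rfl⟩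
  refine ⟨s', hs', funext fun j => ?_⟩
  have hj := lt_varBound v j
  rcases hor s' hs' with hne | heq
  · refine absurd ?_ hne
    rw [hag.of_lt (by omega), hag.of_lt (by omega)]
    simp
  · rw [heq j, hag.of_lt (by omega)]
    simp [hj.ne, (Nat.lt_succ_of_lt hj).ne]

theorem TSat_closureAtom_of_subset [Nontrivial M] (I : Interp S M)
    {A : Set (Fin k → M) → Prop} {v : Fin k → ℕ} {X : Set (ℕ → M)} {R : Set (Fin k → M)}
    (hR : teamProj v X ⊆ R) (hA : A R) (hne : X.Nonempty ∨ R = ∅) :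
    TSat M I (fun _ => A) (closureAtom v) X := by
  simp only [closureAtom, TSat, TSat_exs, TSat_tupleEq, flat_or]
  set N := varBound v
  have hlt (j : Fin k) : v j < N := lt_varBound v j
  set Z : Set (ℕ → M) := {s' | ∃ s ∈ {s' | ∃ s ∈ X, ∃ m : M, s' = Function.update s N m},
    ∃ m : M, s' = Function.update s (N + 1) m}
  have hZv {s : ℕ → M} (hs : s ∈ Z) : (fun j => s (v j)) ∈ R := by
    obtain ⟨_, ⟨s, hs, m, rfl⟩, m', rfl⟩ := hs
    refine hR ⟨s, hs, funext fun j => ?_⟩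
    have := hlt j
    simp [this.ne, (Nat.lt_succ_of_lt this).ne]
  refine ⟨{s' | ∃ s ∈ Z, ∃ f ∈ R, (s (N + 1) = s N → f = fun j => s (v j)) ∧
    s' = setBlock (N + 2) f s}, ⟨?_, ?_⟩, fun s hs => ?_, ?_⟩
  · rintro _ ⟨s, -, f, -, hf, rfl⟩
    rw [setBlock_of_lt (by omega), setBlock_of_lt (by omega)]
    refine (em (s (N + 1) = s N)).symm.imp id fun h j => ?_
    rw [setBlock_add, setBlock_of_lt ((hlt j).trans (by omega)), hf h]
  · convert hA
    ext f
    constructor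
    · rintro ⟨_, ⟨s, -, f, hf, -, rfl⟩, rfl⟩
      simpa [setBlock_add] using hf
    · intro hf
      rcases hne with ⟨s, hs⟩ | rfl
      · obtain ⟨a, b, hab⟩ := exists_pair_ne M
        refine ⟨_, ⟨_, ⟨_, ⟨s, hs, a, rfl⟩, b, rfl⟩, f, hf, fun h => ?_, rfl⟩, ?_⟩
        · simp [hab.symm] at h
        · simp [setBlock_add]
      · exact hf.elim
  · exact ⟨_, ⟨s, hs, _, hZv hs, fun _ => rfl, rfl⟩, agreeOff_setBlock _ _ _⟩
  · rintro _ ⟨s, hs, f, -, -, rfl⟩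
    exact ⟨s, hs, agreeOff_setBlock _ _ _⟩

/-- The sentence `∃ȳ D ȳ`. -/
def existsAtom : TS S Unit fun _ => k := exs (List.range' 0 k) (.dep () (0 + ·))

theorem isSentence_existsAtom : IsSentence (existsAtom : TS S Unit fun _ => k) := by
  simp only [IsSentence, existsAtom, fv_exs, fv, Set.sdiff_eq_empty]
  rintro _ ⟨j, rfl⟩
  simp [List.mem_range'_1]

theorem plain_existsAtom : Plain (existsAtom : TS S Unit fun _ => k) :=
  plain_exs ⟨trivial, trivial⟩

theorem TTrue_existsAtom [Nonempty M] (I : Interp S M) (A : Set (Fin k → M) → Prop) :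
    TTrue M I (fun _ => A) existsAtom ↔ ∃ R : Set (Fin k → M), R.Nonempty ∧ A R := by
  obtain ⟨m⟩ := ‹Nonempty M›
  simp only [TTrue, existsAtom, TSat_exs, TSat]
  constructor
  · rintro ⟨Y, hA, h₁, -⟩
    obtain ⟨s', hs', -⟩ := h₁ (fun _ => m) trivial
    exact ⟨teamProj (0 + ·) Y, ⟨_, s', hs', rfl⟩, hA⟩
  · rintro ⟨R, ⟨f, hf⟩, hA⟩
    refine ⟨{s | ∃ f ∈ R, ∃ s₀, s = setBlock 0 f s₀}, ?_,
      fun s _ => ⟨_, ⟨f, hf, s, rfl⟩, agreeOff_setBlock _ _ _⟩, ?_⟩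
    · convert hA
      ext g
      constructor
      · rintro ⟨_, ⟨f, hf, s, rfl⟩, rfl⟩
        simpa only [setBlock_add] using hf
      · exact fun hg => ⟨_, ⟨g, hg, fun _ => m, rfl⟩, by simp only [setBlock_add]⟩
    · rintro _ ⟨f, -, s, rfl⟩
      exact ⟨s, trivial, agreeOff_setBlock _ _ _⟩

/-! ### Translating formulas with `D↓`-atoms -/

/-- All formulas obtained by replacing every atom by its `closureAtom` or, if `b` holds,
optionally by a formula satisfied by the empty team only. -/
def closureVariants (b : Bool) : TS S Unit (fun _ => k) → List (TS S Unit fun _ => k)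
  | .rel r v => [.rel r v]
  | .nrel r v => [.nrel r v]
  | .eq x y => [.eq x y]
  | .neq x y => [.neq x y]
  | .dep _ v => closureAtom v :: if b then [.al 0 (.neq 0 0)] else []
  | .and φ ψ => (closureVariants b φ).flatMap fun φ' => (closureVariants b ψ).map (.and φ')
  | .or φ ψ => (closureVariants b φ).flatMap fun φ' => (closureVariants b ψ).map (.or φ')
  | .gdisj _ _ => []
  | .cneg _ => []
  | .ex v φ => (closureVariants b φ).map (.ex v)
  | .al v φ => (closureVariants b φ).map (.al v)

theorem fv_closureVariants {b : Bool} {φ φ' : TS S Unit fun _ => k}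
    (h : φ' ∈ closureVariants b φ) : fv φ' ⊆ fv φ := by
  induction φ generalizing φ' with
  | rel | nrel | eq | neq =>
    simp only [closureVariants, List.mem_singleton] at h
    rw [h]
  | dep i v =>
    rcases List.mem_cons.1 h with rfl | h
    · exact fv_closureAtom v
    · cases b <;> simp at h
      simp [h, fv]
  | and φ ψ ih₁ ih₂ | or φ ψ ih₁ ih₂ =>
    simp only [closureVariants, List.mem_flatMap, List.mem_map] at h
    obtain ⟨φ₁, h₁, φ₂, h₂, rfl⟩ := h
    exact Set.union_subset_union (ih₁ h₁) (ih₂ h₂)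
  | gdisj | cneg => simp [closureVariants] at h
  | ex v φ ih | al v φ ih =>
    simp only [closureVariants, List.mem_map] at h
    obtain ⟨φ₁, h₁, rfl⟩ := h
    exact Set.sdiff_subset_sdiff_left (ih h₁)

theorem plain_closureVariants {b : Bool} {φ φ' : TS S Unit fun _ => k}
    (h : φ' ∈ closureVariants b φ) : Plain φ' := by
  induction φ generalizing φ' with
  | rel | nrel | eq | neq =>
    simp only [closureVariants, List.mem_singleton] at h
    simp [h, Plain, NoCneg, NoGdisj]
  | dep i v =>
    rcases List.mem_cons.1 h with rfl | h
    · exact plain_closureAtom v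
    · cases b <;> simp at h
      simp [h, Plain, NoCneg, NoGdisj]
  | and φ ψ ih₁ ih₂ | or φ ψ ih₁ ih₂ =>
    simp only [closureVariants, List.mem_flatMap, List.mem_map] at h
    obtain ⟨φ₁, h₁, φ₂, h₂, rfl⟩ := h
    exact ⟨⟨(ih₁ h₁).1, (ih₂ h₂).1⟩, (ih₁ h₁).2, (ih₂ h₂).2⟩
  | gdisj | cneg => simp [closureVariants] at h
  | ex v φ ih | al v φ ih =>
    simp only [closureVariants, List.mem_map] at h
    obtain ⟨φ₁, h₁, rfl⟩ := h
    exact (ih h₁ : Plain φ₁)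

theorem TSat_of_closureVariants [Nonempty M] (I : Interp S M) {A : Set (Fin k → M) → Prop}
    {b : Bool} (hb : b = true → downClosure A ∅) {φ φ' : TS S Unit fun _ => k}
    (h : φ' ∈ closureVariants b φ) {X : Set (ℕ → M)} (hX : TSat M I (fun _ => A) φ' X) :
    TSat M I (fun _ => downClosure A) φ X := by
  induction φ generalizing φ' X with
  | rel | nrel | eq | neq =>
    simp only [closureVariants, List.mem_singleton] at h
    subst h
    exact hX
  | dep i v =>
    rcases List.mem_cons.1 h with rfl | h
    · exact downClosure_of_TSat_closureAtom I hX
    · cases b <;> simp at h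
      subst h
      obtain ⟨m⟩ := ‹Nonempty M›
      have hempty : X = ∅ := Set.eq_empty_of_forall_notMem fun s hs =>
        hX _ ⟨s, hs, m, rfl⟩ rfl
      have : teamProj v X = ∅ := by simp [hempty, teamProj]
      simpa only [TSat, this] using hb rfl
  | and φ ψ ih₁ ih₂ =>
    simp only [closureVariants, List.mem_flatMap, List.mem_map] at h
    obtain ⟨φ₁, h₁, φ₂, h₂, rfl⟩ := h
    exact ⟨ih₁ h₁ hX.1, ih₂ h₂ hX.2⟩
  | or φ ψ ih₁ ih₂ =>
    simp only [closureVariants, List.mem_flatMap, List.mem_map] at h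
    obtain ⟨φ₁, h₁, φ₂, h₂, rfl⟩ := h
    obtain ⟨Y, Z, hYZ, hY, hZ⟩ := hX
    exact ⟨Y, Z, hYZ, ih₁ h₁ hY, ih₂ h₂ hZ⟩
  | gdisj | cneg => simp [closureVariants] at h
  | ex v φ ih =>
    simp only [closureVariants, List.mem_map] at h
    obtain ⟨φ₁, h₁, rfl⟩ := h
    obtain ⟨H, hne, hH⟩ := hX
    exact ⟨H, hne, ih h₁ hH⟩
  | al v φ ih =>
    simp only [closureVariants, List.mem_map] at h
    obtain ⟨φ₁, h₁, rfl⟩ := h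
    exact ih h₁ hX

theorem exists_closureVariants_of_TSat [Nontrivial M] (I : Interp S M)
    {A : Set (Fin k → M) → Prop} {b : Bool} (hb : b = false → ∀ R, A R → R = ∅)
    {φ : TS S Unit fun _ => k} (hφ : Plain φ) {X : Set (ℕ → M)}
    (hX : TSat M I (fun _ => downClosure A) φ X) :
    ∃ φ' ∈ closureVariants b φ, TSat M I (fun _ => A) φ' X := by
  induction φ generalizing X with
  | rel | nrel | eq | neq => exact ⟨_, List.mem_singleton.2 rfl, hX⟩
  | dep i v =>
    obtain ⟨R, hR, hA⟩ := hX
    rcases X.eq_empty_or_nonempty with rfl | hne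
    · cases b
      · exact ⟨_, by simp [closureVariants],
          TSat_closureAtom_of_subset I hR hA (.inr (hb rfl R hA))⟩
      · exact ⟨.al 0 (.neq 0 0), by simp [closureVariants], by simp [TSat]⟩
    · exact ⟨_, by simp [closureVariants], TSat_closureAtom_of_subset I hR hA (.inl hne)⟩
  | and φ ψ ih₁ ih₂ =>
    obtain ⟨⟨c₁, c₂⟩, g₁, g₂⟩ := hφ
    obtain ⟨φ₁, h₁, t₁⟩ := ih₁ ⟨c₁, g₁⟩ hX.1
    obtain ⟨φ₂, h₂, t₂⟩ := ih₂ ⟨c₂, g₂⟩ hX.2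
    exact ⟨.and φ₁ φ₂, by simp [closureVariants, h₁, h₂], t₁, t₂⟩
  | or φ ψ ih₁ ih₂ =>
    obtain ⟨⟨c₁, c₂⟩, g₁, g₂⟩ := hφ
    obtain ⟨Y, Z, hYZ, hY, hZ⟩ := hX
    obtain ⟨φ₁, h₁, t₁⟩ := ih₁ ⟨c₁, g₁⟩ hY
    obtain ⟨φ₂, h₂, t₂⟩ := ih₂ ⟨c₂, g₂⟩ hZ
    exact ⟨.or φ₁ φ₂, by simp [closureVariants, h₁, h₂], Y, Z, hYZ, t₁, t₂⟩
  | gdisj => exact hφ.2.elim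
  | cneg => exact hφ.1.elim
  | ex v φ ih =>
    obtain ⟨H, hne, hH⟩ := hX
    obtain ⟨φ₁, h₁, t₁⟩ := ih hφ hH
    exact ⟨.ex v φ₁, by simp [closureVariants, h₁], H, hne, t₁⟩
  | al v φ ih =>
    obtain ⟨φ₁, h₁, t₁⟩ := ih hφ hX
    exact ⟨.al v φ₁, by simp [closureVariants, h₁], t₁⟩

theorem TTrue_downClosure_iff [Nontrivial M] (I : Interp S M) (A : Set (Fin k → M) → Prop)
    {φ : TS S Unit fun _ => k} (hφ : Plain φ) :
    TTrue M I (fun _ => downClosure A) φ ↔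
      (∃ φ' ∈ closureVariants false φ, TTrue M I (fun _ => A) φ') ∨
      (TTrue M I (fun _ => A) existsAtom ∧
        ∃ φ' ∈ closureVariants true φ, TTrue M I (fun _ => A) φ') := by
  rw [TTrue_existsAtom]
  constructor
  · intro h
    by_cases hA : ∃ R : Set (Fin k → M), R.Nonempty ∧ A R
    · exact .inr ⟨hA, exists_closureVariants_of_TSat I (by simp) hφ h⟩
    · refine .inl (exists_closureVariants_of_TSat I (fun _ R hR => ?_) hφ h)
      exact Set.not_nonempty_iff_eq_empty.1 fun hne => hA ⟨R, hne, hR⟩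
  · rintro (⟨φ', hφ', h⟩ | ⟨⟨R, -, hR⟩, φ', hφ', h⟩)
    · exact TSat_of_closureVariants I (by simp) hφ' h
    · exact TSat_of_closureVariants I (fun _ => ⟨R, Set.empty_subset R, hR⟩) hφ' h

/-- If all plain sentences with atoms interpreted by `A` are first-order definable, then so
are those with atoms interpreted by the downwards closure of `A`. -/
theorem FODefinable_downClosure (A : ∀ M : Type, Interp S M → Set (Fin k → M) → Prop)
    (hA : ∀ φ : TS S Unit fun _ => k, IsSentence φ → Plain φ →
      FODefinable fun M I => TTrue M I (fun _ => A M I) φ)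
    {φ : TS S Unit fun _ => k} (hs : IsSentence φ) (hφ : Plain φ) :
    FODefinable fun M I => TTrue M I (fun _ => downClosure (A M I)) φ := by
  have hv (b : Bool) : FODefinable fun M I =>
      ∃ φ' ∈ closureVariants b φ, TTrue M I (fun _ => A M I) φ' :=
    .exists_mem _ fun φ' h' => hA φ'
      (Set.subset_eq_empty (fv_closureVariants h') hs) (plain_closureVariants h')
  obtain ⟨ψ, hψ, H⟩ := (hv false).or
    ((hA existsAtom isSentence_existsAtom plain_existsAtom).and (hv true))
  exact ⟨ψ, hψ, fun M hM I => (TTrue_downClosure_iff I _ hφ).trans (H M hM I)⟩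

theorem relSem_dClosure (D : DepPred k) (P : S 1) (I : Interp S M) :
    relSem (dClosure D) P M I = downClosure (relSem D P M I) := by
  ext R
  constructor
  · rintro ⟨hP, R', hR, hD⟩
    refine ⟨(fun g j => (g j : M)) '' R', fun f hf => ?_, ?_, ?_⟩
    · exact ⟨fun j => ⟨f j, hP f hf j⟩, hR hf, rfl⟩
    · rintro _ ⟨g, -, rfl⟩ j
      exact (g j).2
    · have hinj : Function.Injective fun (g : Fin k → PSet I P) j => (g j : M) :=
        fun g g' h => funext fun j => Subtype.ext (congrFun h j)
      convert hD
      exact Set.preimage_image_eq R' hinj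
  · rintro ⟨R', hR, hP, hD⟩
    exact ⟨fun f hf => hP f (hR hf), _, fun g hg => hR hg, hD⟩

end DownwardClosure

/-- If `D` is strongly first order, so is `D↓`; and if `D` is
moreover relativizable, so is `D↓`. -/
theorem dClosure_sfo_and_relativizable {k : ℕ} (D : DepPred k)
    (hiso : IsoClosed D) (hsfo : SFOd D) :
    SFOd (dClosure D) ∧ (Relativizable1 D → Relativizable1 (dClosure D)) := by
  refine ⟨fun S φ hs hφ => ?_, fun hrel S P φ hs hφ => ?_⟩
  · exact FODefinable_downClosure (fun M _ => D M) (hsfo S) hs hφ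
  · obtain ⟨ψ, hψ, H⟩ := FODefinable_downClosure (fun M I => relSem D P M I) (fun θ hθ hθp => by
      obtain ⟨θ', hθ', hθp', H'⟩ := hrel S P θ hθ hθp
      obtain ⟨ψ, hψ, H⟩ := hsfo S θ' hθ' hθp'
      exact ⟨ψ, hψ, fun M hM I => (H' M hM I).trans (H M hM I)⟩) hs hφ
    refine ⟨nnf true ψ, (fv_nnf true ψ).trans hψ, plain_nnf true ψ, fun M hM I => ?_⟩
    simp only [relSem_dClosure]
    refine (H M hM I).trans ?_
    rw [TTrue, TSat_nnf]
    simp [FOTrue]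

end DSFO
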